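/- Let X_1,…,X_n be finite sets with |X_i| = N_i, and for A ⊆ [n] let N_A = Π_{i∈A} N_i. If A ⊆ [n] and k ≥ N_{[n]∖A}, then the maximal information divergence from the mixture of k product distributions satisfies D_{ℳ_{n,k}} ≤ log(N_A / max_{j∈A} N_j). -/

import Mathlib

open scoped BigOperators

section Prelim

variable {𝒳 : Type*} [Fintype 𝒳]

/-- A probability distribution on the finite set `𝒳`, as a nonnegative function summing to 1. -/
def IsProb (p : 𝒳 → ℝ) : Prop := (∀ x, 0 ≤ p x) ∧ ∑ x, p x = 1

/-- Kullback–Leibler divergence with the conventions `0·log 0 = 0` and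
`D(p‖q) = ∞` if `supp p ⊄ supp q`. -/
noncomputable def KL (p q : 𝒳 → ℝ) : EReal :=
  if ∀ x, p x ≠ 0 → q x ≠ 0 then ((∑ x, p x * Real.log (p x / q x) : ℝ) : EReal)
  else ⊤

/-- Information divergence from a model: `D(p‖ℳ) = inf_{q ∈ ℳ} D(p‖q)`. -/
noncomputable def divFrom (p : 𝒳 → ℝ) (M : Set (𝒳 → ℝ)) : EReal :=
  ⨅ q ∈ M, KL p q

/-- Maximal information divergence from a model: `D_ℳ = max_{p ∈ Δ(𝒳)} D(p‖ℳ)`. -/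
noncomputable def maxDiv (M : Set (𝒳 → ℝ)) : EReal :=
  ⨆ (p : 𝒳 → ℝ) (_ : IsProb p), divFrom p M

end Prelim

/-- The naïve Bayes model (mixture of $k$ product distributions). -/
def mixProd {n : ℕ} (X : Fin n → Type*) [∀ i, Fintype (X i)] (k : ℕ) :
    Set ((∀ i, X i) → ℝ) :=
  {p | ∃ (l : Fin k → ℝ) (f : Fin k → ∀ i, X i → ℝ),
    (∀ j, 0 ≤ l j) ∧ ∑ j, l j = 1 ∧ (∀ j i, IsProb (f j i)) ∧
    ∀ x, p x = ∑ j, l j * ∏ i, f j i (x i)}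

/-- The uniform distribution on a nonempty finite set is a probability distribution. -/
theorem isProb_uniform (α : Type*) [Fintype α] [Nonempty α] :
    IsProb (fun _ : α => (Fintype.card α : ℝ)⁻¹) :=
  ⟨fun _ => by positivity, by simp⟩

/-- Pointwise domination `p ≤ C * q` bounds the divergence of `p` from `q` by `log C`. -/
theorem KL_le_log_of_le_mul {α : Type*} [Fintype α] {p q : α → ℝ} {C : ℝ} (hp : IsProb p)
    (hq : ∀ x, 0 ≤ q x) (hpq : ∀ x, p x ≤ C * q x) :
    KL p q ≤ (Real.log C : EReal) := by
  have hpos : ∀ x, p x ≠ 0 → 0 < p x ∧ 0 < q x := by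
    intro x hx
    have hx' : 0 < p x := lt_of_le_of_ne (hp.1 x) hx.symm
    refine ⟨hx', lt_of_le_of_ne (hq x) fun h => ?_⟩
    have := hpq x
    rw [← h, mul_zero] at this
    linarith
  rw [KL, if_pos fun x hx => (hpos x hx).2.ne', EReal.coe_le_coe_iff]
  calc ∑ x, p x * Real.log (p x / q x) ≤ ∑ x, p x * Real.log C := by
        refine Finset.sum_le_sum fun x _ => ?_
        by_cases hx : p x = 0
        · simp [hx]
        · obtain ⟨hpx, hqx⟩ := hpos x hx
          exact mul_le_mul_of_nonneg_left
            (Real.log_le_log (div_pos hpx hqx) ((div_le_iff₀ hqx).2 (hpq x))) hpx.le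
    _ = Real.log C := by rw [← Finset.sum_mul, hp.2, one_mul]

/-- A mixture of product distributions indexed by at most `k` elements lies in `mixProd X k`. -/
theorem mem_mixProd_of_card_le {n : ℕ} {X : Fin n → Type*} [∀ i, Fintype (X i)]
    [∀ i, Nonempty (X i)] {ι : Type*} [Fintype ι] {k : ℕ} (hk : Fintype.card ι ≤ k)
    (l : ι → ℝ) (f : ι → ∀ i, X i → ℝ) (hl : ∀ y, 0 ≤ l y) (hl1 : ∑ y, l y = 1)
    (hf : ∀ y i, IsProb (f y i)) :
    (fun x => ∑ y, l y * ∏ i, f y i (x i)) ∈ mixProd X k := by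
  obtain ⟨e⟩ : Nonempty (ι ↪ Fin k) := Function.Embedding.nonempty_of_card_le (by simpa using hk)
  let u : Fin k → ∀ i, X i → ℝ := fun _ i _ => (Fintype.card (X i) : ℝ)⁻¹
  have hl' : ∀ j, j ∉ Set.range e → Function.extend e l 0 j = 0 := fun j hj =>
    Function.extend_apply' _ _ _ hj
  refine ⟨Function.extend e l 0, Function.extend e f u, fun j => ?_, ?_, fun j i => ?_,
    fun x => ?_⟩
  · by_cases hj : j ∈ Set.range e
    · obtain ⟨y, rfl⟩ := hj
      rw [e.injective.extend_apply]
      exact hl y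
    · exact (hl' j hj).ge
  · rw [← hl1]
    exact (Fintype.sum_of_injective e e.injective _ _ hl'
      fun y => (e.injective.extend_apply _ _ y).symm).symm
  · by_cases hj : j ∈ Set.range e
    · obtain ⟨y, rfl⟩ := hj
      rw [e.injective.extend_apply]
      exact hf y i
    · rw [Function.extend_apply' _ _ _ hj]
      exact isProb_uniform (X i)
  · refine Fintype.sum_of_injective e e.injective _ _ (fun j hj => ?_) fun y => ?_
    · rw [hl' j hj, zero_mul]
    · rw [e.injective.extend_apply, e.injective.extend_apply]

open Classical in
/-- Every distribution `p` is dominated, up to the factor `∏ i ∈ A \ {j}, |X i|`, by a mixture of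
`∏ i ∉ A, |X i|` products: condition on the coordinates outside `A`, keep the conditional
marginal of the coordinate `j`, and make the other coordinates uniform. -/
theorem exists_mem_mixProd_le_mul {n : ℕ} {X : Fin n → Type*} [∀ i, Fintype (X i)]
    [∀ i, Nonempty (X i)] {k : ℕ} {A : Finset (Fin n)} {j : Fin n} (hj : j ∈ A)
    (hk : ∏ i ∈ Aᶜ, Fintype.card (X i) ≤ k) {p : (∀ i, X i) → ℝ} (hp : IsProb p) :
    ∃ q ∈ mixProd X k, (∀ x, 0 ≤ q x) ∧
      ∀ x, p x ≤ (∏ i ∈ A.erase j, (Fintype.card (X i) : ℝ)) * q x := by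
  let r : (∀ i, X i) → ∀ i : (Aᶜ : Finset (Fin n)), X i := fun z i => z i
  let l : (∀ i : (Aᶜ : Finset (Fin n)), X i) → ℝ := fun y => ∑ z, if r z = y then p z else 0
  let m : (∀ i : (Aᶜ : Finset (Fin n)), X i) → ∀ i, X i → ℝ := fun y i a =>
    ∑ z, if z i = a then (if r z = y then p z else 0) else 0
  let f : (∀ i : (Aᶜ : Finset (Fin n)), X i) → ∀ i, X i → ℝ := fun y i a =>
    if i ∉ A.erase j ∧ l y ≠ 0 then m y i a / l y else (Fintype.card (X i) : ℝ)⁻¹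
  have hterm : ∀ y z, 0 ≤ if r z = y then p z else 0 := fun y z => by
    split_ifs
    exacts [hp.1 z, le_rfl]
  have hterm' : ∀ y i a z, 0 ≤ if z i = a then (if r z = y then p z else 0) else 0 :=
    fun y i a z => by
      split_ifs
      exacts [hp.1 z, le_rfl, le_rfl]
  have hl : ∀ y, 0 ≤ l y := fun y => Finset.sum_nonneg fun z _ => hterm y z
  have hl1 : ∑ y, l y = 1 := by
    rw [Finset.sum_comm, ← hp.2]
    simp
  have hm : ∀ y i a, 0 ≤ m y i a := fun y i a => Finset.sum_nonneg fun z _ => hterm' y i a z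
  have hm1 : ∀ y i, ∑ a, m y i a = l y := fun y i => by
    rw [Finset.sum_comm]
    simp [l]
  have hf : ∀ y i, IsProb (f y i) := by
    intro y i
    by_cases h : i ∉ A.erase j ∧ l y ≠ 0
    · simp only [f, if_pos h]
      exact ⟨fun a => div_nonneg (hm y i a) (hl y), by
        rw [← Finset.sum_div, hm1, div_self h.2]⟩
    · simp only [f, if_neg h]
      exact isProb_uniform (X i)
  have hnonneg : ∀ (x : ∀ i, X i) y, 0 ≤ l y * ∏ i, f y i (x i) := fun x y =>
    mul_nonneg (hl y) (Finset.prod_nonneg fun i _ => (hf y i).1 _)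
  refine ⟨_, mem_mixProd_of_card_le ?_ l f hl hl1 hf,
    fun x => Finset.sum_nonneg fun y _ => hnonneg x y, fun x => ?_⟩
  · rwa [Fintype.card_pi, Finset.prod_coe_sort Aᶜ fun i => Fintype.card (X i)]
  have hpm : p x ≤ m (r x) j (x j) := by
    simpa using Finset.single_le_sum (fun z _ => hterm' (r x) j (x j) z) (Finset.mem_univ x)
  have hpl : p x ≤ l (r x) := by
    simpa using Finset.single_le_sum (fun z _ => hterm (r x) z) (Finset.mem_univ x)
  have hC : 0 < ∏ i ∈ A.erase j, (Fintype.card (X i) : ℝ) :=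
    Finset.prod_pos fun i _ => by exact_mod_cast Fintype.card_pos
  by_cases hlx : l (r x) = 0
  · exact (hpl.trans_eq hlx).trans
      (mul_nonneg hC.le (Finset.sum_nonneg fun y _ => hnonneg x y))
  have hprod : ∏ i, f (r x) i (x i) =
      m (r x) j (x j) / l (r x) * (∏ i ∈ A.erase j, (Fintype.card (X i) : ℝ))⁻¹ := by
    have hout : ∏ i ∈ Aᶜ, f (r x) i (x i) = 1 := by
      refine Finset.prod_eq_one fun i hi => ?_
      have hiA : i ∉ A := Finset.mem_compl.1 hi
      have hml : m (r x) i (x i) = l (r x) := by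
        refine Finset.sum_congr rfl fun z _ => ?_
        by_cases hz : r z = r x
        · rw [if_pos (congrFun hz ⟨i, hi⟩)]
        · simp [hz]
      simp only [f]
      rw [if_pos ⟨fun h => hiA (Finset.mem_of_mem_erase h), hlx⟩, hml, div_self hlx]
    rw [← Finset.prod_mul_prod_compl A, hout, mul_one, ← Finset.mul_prod_erase A _ hj,
      ← Finset.prod_inv_distrib]
    congr 1
    · simp only [f]
      rw [if_pos ⟨Finset.notMem_erase j A, hlx⟩]
    · exact Finset.prod_congr rfl fun i hi => if_neg fun h => h.1 hi
  calc p x ≤ m (r x) j (x j) := hpm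
    _ = (∏ i ∈ A.erase j, (Fintype.card (X i) : ℝ)) * (l (r x) * ∏ i, f (r x) i (x i)) := by
        rw [hprod]
        field_simp
    _ ≤ _ := mul_le_mul_of_nonneg_left
        (Finset.single_le_sum (fun y _ => hnonneg x y) (Finset.mem_univ (r x))) hC.le

/-- if $k ≥ N_{[n]∖A}$ then $D_{ℳ_{n,k}} ≤ \log(N_A / \max_{j∈A} N_j)$. -/
theorem maxDiv_mixProd_le {n : ℕ} (X : Fin n → Type)
    [∀ i, Fintype (X i)] [∀ i, Nonempty (X i)] (k : ℕ)
    (A : Finset (Fin n)) (hA : A.Nonempty)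
    (hk : ∏ i ∈ Aᶜ, Fintype.card (X i) ≤ k) :
    maxDiv (mixProd X k) ≤
      ((Real.log (((∏ i ∈ A, Fintype.card (X i) : ℕ) : ℝ) /
        (((A.sup fun j : Fin n => Fintype.card (X j)) : ℕ) : ℝ))) : EReal) := by
  obtain ⟨j, hj, hmax⟩ := Finset.exists_mem_eq_sup A hA fun j : Fin n => Fintype.card (X j)
  have hcard : (Fintype.card (X j) : ℝ) ≠ 0 := by exact_mod_cast Fintype.card_ne_zero
  have hratio : ((∏ i ∈ A, Fintype.card (X i) : ℕ) : ℝ) /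
      (((A.sup fun j : Fin n => Fintype.card (X j)) : ℕ) : ℝ) =
      ∏ i ∈ A.erase j, (Fintype.card (X i) : ℝ) := by
    rw [hmax, Nat.cast_prod, ← Finset.mul_prod_erase A _ hj, mul_div_cancel_left₀ _ hcard]
  rw [hratio]
  refine iSup₂_le fun p hp => ?_
  obtain ⟨q, hqM, hq, hpq⟩ := exists_mem_mixProd_le_mul hj hk hp
  exact (iInf₂_le q hqM).trans (KL_le_log_of_le_mul hp hq hpq)
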